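/- Let p ∈ (0,1) and β = (1/2)·log((1−p)/p). Let c ∈ {−1,+1}^{Z²_*} and η = Γ(c). Let Λ_* be a finite subset of Z²_* whose complement is connected in the nearest-neighbour graph of Z²_* (e.g. Λ_* simply connected), and let E(Λ_*) be the set of edges e ∈ E₂ such that e_* has at least one endpoint in Λ_*. Then the finite-volume even percolation measure μ^p_{E(Λ_*),η} is the image of the finite-volume Ising measure Π^β_{Λ_*,c} under the contour map Γ. -/

import Mathlib

open MeasureTheory
open scoped BigOperators

noncomputable section

/-- Vertices of the square lattice `ℤ²`. -/
abbrev V : Type := ℤ × ℤ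

/-- Nearest-neighbour adjacency on `ℤ²` (`ℓ¹`-distance one). -/
def latAdj (x y : V) : Prop := |x.1 - y.1| + |x.2 - y.2| = 1

/-- The edge set `E₂` of the square lattice, as a set of unordered pairs of vertices. -/
def E2 : Set (Sym2 V) := {e | ∃ x y : V, latAdj x y ∧ e = s(x, y)}

abbrev Edge : Type := ↥E2

/-- An edge configuration: an element of `{0,1}^{E₂}` (`true` = open). -/
abbrev Config : Type := Edge → Bool

/-- The four unit directions. -/
def dir : Fin 4 → V := ![(1, 0), (-1, 0), (0, 1), (0, -1)]

lemma latAdj_dir (x : V) (d : Fin 4) : latAdj x (x + dir d) := by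
  fin_cases d <;> simp [latAdj, dir, Prod.fst_add, Prod.snd_add]

/-- The edge from `x` in direction `d`, as an element of `E₂`. -/
def incEdge (x : V) (d : Fin 4) : Edge :=
  ⟨s(x, x + dir d), ⟨x, x + dir d, latAdj_dir x d, rfl⟩⟩

/-- The vertex `x` has even degree in the configuration `ω` (the four incident edges
of `x` are `incEdge x d`, `d : Fin 4`, each counted once). -/
def degEven (ω : Config) (x : V) : Prop :=
  Even ((Finset.univ.filter (fun d : Fin 4 => ω (incEdge x d) = true)).card)

/-- The set `Ω_EP` of even (Eulerian) configurations. -/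
def ΩEP : Set Config := {ω | ∀ x : V, degEven ω x}

/-- Concatenation: the configuration equal to `η` on `Λ` and to `ω` off `Λ`. -/
def patch (Λ : Finset Edge) (η : ↥Λ → Bool) (ω : Config) : Config :=
  fun e => if h : e ∈ Λ then η ⟨e, h⟩ else ω e

def qratio (p : ℝ) : ℝ := p / (1 - p)

/-- Number of open edges in a local configuration. -/
def numOpen {Λ : Finset Edge} (η : ↥Λ → Bool) : ℕ :=
  (Finset.univ.filter (fun e : ↥Λ => η e = true)).card

open Classical in
/-- The operator `M^p_Λ`. -/
def Mop (p : ℝ) (Λ : Finset Edge) (f : Config → ℝ) (ω : Config) : ℝ :=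
  ∑ η : ↥Λ → Bool,
    (if patch Λ η ω ∈ ΩEP then f (patch Λ η ω) * qratio p ^ numOpen η else 0)

/-- The finite-volume conditional expectation `μ^p_Λ f = (M^p_Λ f)/(M^p_Λ 1)`. -/
def muOp (p : ℝ) (Λ : Finset Edge) (f : Config → ℝ) (ω : Config) : ℝ :=
  Mop p Λ f ω / Mop p Λ (fun _ => 1) ω

/-- `μ` is a Gibbs measure for Eulerian percolation with opening parameter `p`. -/
def IsGibbsEP (p : ℝ) (μ : Measure Config) : Prop :=
  IsProbabilityMeasure μ ∧ μ ΩEP = 1 ∧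
    ∀ f : Config → ℝ, Continuous f → ∀ Λ : Finset Edge,
      ∫ ω, f ω ∂μ = ∫ ω, muOp p Λ f ω ∂μ

/-- Spin configurations on the dual lattice `ℤ²_* = (1/2,1/2) + ℤ²`, with dual sites
indexed by `ℤ²` (the index `u` stands for the dual point `u + (1/2,1/2)`);
`true` stands for spin `+1` and `false` for spin `-1`. -/
abbrev SpinConfig : Type := V → Bool

/-- The value `±1` of a spin. -/
def spinVal (b : Bool) : ℝ := if b then 1 else -1

/-- The two endpoints (in dual coordinates) of the dual edge `e_*` crossing the
primal edge `{x, y}`. -/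
def dualSites (x y : V) : V × V :=
  let m : V := (x.1 ⊓ y.1, x.2 ⊓ y.2)
  if x.2 = y.2 then (m, (m.1, m.2 - 1)) else (m, (m.1 - 1, m.2))

lemma dualSites_comm (x y : V) : dualSites x y = dualSites y x := by
  unfold dualSites
  by_cases h : x.2 = y.2
  · rw [if_pos h, if_pos h.symm]
    simp [inf_comm]
  · rw [if_neg h, if_neg (fun hh => h hh.symm)]
    simp [inf_comm]

def contourPair (σ : SpinConfig) (x y : V) : Bool :=
  σ (dualSites x y).1 != σ (dualSites x y).2

/-- The contour map `Γ`: the edge `e` is open in `Γ(σ)` iff the spins of `σ` at the two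
endpoints of the dual edge `e_*` differ. -/
def contour (σ : SpinConfig) : Config :=
  fun e => Sym2.lift ⟨fun x y => contourPair σ x y,
    fun x y => by simp only [contourPair, dualSites_comm]⟩ e.1

/-- The dual edges meeting a finite set `Λ` of dual sites (each dual edge recorded once,
as an unordered pair of dual sites). -/
def dualEdges (Λ : Finset V) : Finset (Sym2 V) :=
  (Λ ×ˢ (Finset.univ : Finset (Fin 4))).image (fun pr => s(pr.1, pr.1 + dir pr.2))

def pairEnergy (σ : SpinConfig) : Sym2 V → ℝ :=
  Sym2.lift ⟨fun x y => spinVal (σ x) * spinVal (σ y), fun _ _ => mul_comm _ _⟩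

/-- The Hamiltonian `H_Λ(σ) = -∑ σ_x σ_y`, the sum running over dual edges meeting `Λ`. -/
def hamiltonian (Λ : Finset V) (σ : SpinConfig) : ℝ :=
  - ∑ e ∈ dualEdges Λ, pairEnergy σ e

/-- Concatenation of spin configurations. -/
def spatch (Λ : Finset V) (η : ↥Λ → Bool) (σ : SpinConfig) : SpinConfig :=
  fun x => if h : x ∈ Λ then η ⟨x, h⟩ else σ x

/-- The partition function `Z^β_Λ(σ)`. -/
def Zpart (β : ℝ) (Λ : Finset V) (σ : SpinConfig) : ℝ :=
  ∑ η : ↥Λ → Bool, Real.exp (-β * hamiltonian Λ (spatch Λ η σ))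

/-- The finite-volume Gibbs kernel `Π^β_Λ` of the Ising model. -/
def PiOp (β : ℝ) (Λ : Finset V) (f : SpinConfig → ℝ) (σ : SpinConfig) : ℝ :=
  (∑ η : ↥Λ → Bool, Real.exp (-β * hamiltonian Λ (spatch Λ η σ)) * f (spatch Λ η σ)) /
    Zpart β Λ σ

/-- `γ` is a Gibbs measure for the Ising model on the dual lattice with parameter `β`. -/
def IsGibbsIsing (β : ℝ) (γ : Measure SpinConfig) : Prop :=
  IsProbabilityMeasure γ ∧
    ∀ f : SpinConfig → ℝ, Continuous f → ∀ Λ : Finset V,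
      ∫ σ, f σ ∂γ = ∫ σ, PiOp β Λ f σ ∂γ

/-- The primal edge crossed by the dual step from dual site `a` to dual site `b`
(dual sites in dual coordinates: `u` stands for `u + (1/2,1/2)`). -/
def crossEdge (a b : V) : Sym2 V :=
  let M : V := (a.1 ⊔ b.1, a.2 ⊔ b.2)
  if a.2 = b.2 then s(M, (M.1, M.2 + 1)) else s(M, (M.1 + 1, M.2))

lemma crossEdge_mem (a b : V) : crossEdge a b ∈ E2 := by
  unfold crossEdge
  by_cases h : a.2 = b.2
  · rw [if_pos h]
    exact ⟨_, _, by simp [latAdj], rfl⟩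
  · rw [if_neg h]
    exact ⟨_, _, by simp [latAdj], rfl⟩

/-- The number of `η`-open edges of `E₂` crossed by the dual path `γ` (counted with
multiplicity along the path). -/
def crossCount (η : Config) (n : ℕ) (γ : Fin (n + 1) → V) : ℕ :=
  ∑ i : Fin n,
    if η ⟨crossEdge (γ i.castSucc) (γ i.succ), crossEdge_mem _ _⟩ = true then 1 else 0


open Classical in
/-- The weight of a local even-percolation configuration. -/
def epWeight (p : ℝ) (Λ : Finset Edge) (ω : Config) (η : ↥Λ → Bool) : ℝ :=
  if patch Λ η ω ∈ ΩEP then qratio p ^ numOpen η else 0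

/-- The finite-volume Eulerian percolation measure `μ^p_{Λ,ω}` with boundary condition
`ω`: it charges the even configurations agreeing with `ω` off `Λ`, proportionally to
`(p/(1-p))^{number of open edges in Λ}`. -/
def epFinVol (p : ℝ) (Λ : Finset Edge) (ω : Config) : Measure Config :=
  (∑ η : ↥Λ → Bool, ENNReal.ofReal (epWeight p Λ ω η))⁻¹ •
    ∑ η : ↥Λ → Bool, ENNReal.ofReal (epWeight p Λ ω η) • Measure.dirac (patch Λ η ω)

/-- The finite-volume Ising measure `Π^β_{Λ,c}` with boundary condition `c`: it charges
the spin configurations agreeing with `c` off `Λ`, proportionally to `exp(-β H_Λ(·))`. -/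
def isingFinVol (β : ℝ) (Λ : Finset V) (c : SpinConfig) : Measure SpinConfig :=
  (ENNReal.ofReal (Zpart β Λ c))⁻¹ •
    ∑ η : ↥Λ → Bool,
      ENNReal.ofReal (Real.exp (-β * hamiltonian Λ (spatch Λ η c))) •
        Measure.dirac (spatch Λ η c)

/-- `E(Λ_*)`: the set of primal edges `e` whose dual edge `e_*` has at least one
endpoint in `Λ_*` (each such edge is crossed by a dual step starting in `Λ_*`). -/
def EOf (Λ : Finset V) : Finset Edge :=
  (Λ ×ˢ (Finset.univ : Finset (Fin 4))).image
    (fun pr => (⟨crossEdge pr.1 (pr.1 + dir pr.2), crossEdge_mem _ _⟩ : Edge))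

/-- The complement of `Λ` is connected in the nearest-neighbour graph of the (dual)
lattice (this holds in particular when `Λ` is simply connected). -/
def ComplConnected (Λ : Finset V) : Prop :=
  ∀ x y : V, x ∉ Λ → y ∉ Λ →
    ∃ (n : ℕ) (γ : Fin (n + 1) → V), γ 0 = x ∧ γ (Fin.last n) = y ∧
      (∀ i : Fin n, latAdj (γ i.castSucc) (γ i.succ)) ∧ (∀ i, γ i ∉ Λ)

lemma latAdj.exists_dir {a b : V} (h : latAdj a b) : ∃ d, b = a + dir d := by
  obtain ⟨a1, a2⟩ := a
  obtain ⟨b1, b2⟩ := b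
  have h' : (b1 = a1 + 1 ∧ b2 = a2) ∨ (b1 = a1 - 1 ∧ b2 = a2) ∨ (b1 = a1 ∧ b2 = a2 + 1) ∨
      (b1 = a1 ∧ b2 = a2 - 1) := by
    simp only [latAdj] at h
    rcases abs_cases (a1 - b1) with h1 | h1 <;> rcases abs_cases (a2 - b2) with h2 | h2 <;> omega
  rcases h' with h | h | h | h
  · exact ⟨0, by simp [dir, h]⟩
  · exact ⟨1, by simp [dir, h, sub_eq_add_neg]⟩
  · exact ⟨2, by simp [dir, h]⟩
  · exact ⟨3, by simp [dir, h, sub_eq_add_neg]⟩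

/-- The dual edge crossing a primal edge. -/
def dualEdge : Sym2 V → Sym2 V :=
  Sym2.lift ⟨fun x y => s((dualSites x y).1, (dualSites x y).2),
    fun x y => by simp only [dualSites_comm]⟩

lemma dualEdge_crossEdge (a : V) (d : Fin 4) :
    dualEdge (crossEdge a (a + dir d)) = s(a, a + dir d) := by
  obtain ⟨a1, a2⟩ := a
  fin_cases d <;> simp [crossEdge, dir, dualEdge, dualSites, sub_eq_add_neg]

/-- The primal edge crossed by the step in direction `d` from the dual site `a`. -/
def crossing (a : V) (d : Fin 4) : Edge := ⟨crossEdge a (a + dir d), crossEdge_mem _ _⟩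

lemma exists_crossing (e : Edge) : ∃ a d, e = crossing a d := by
  obtain ⟨e, x, y, hxy, rfl⟩ := e
  obtain ⟨d, rfl⟩ := hxy.exists_dir
  obtain ⟨x1, x2⟩ := x
  fin_cases d
  · exact ⟨(x1, x2), 3, by simp [crossing, crossEdge, dir]⟩
  · exact ⟨(x1 - 1, x2), 3, by simp [crossing, crossEdge, dir, sub_eq_add_neg]⟩
  · exact ⟨(x1, x2), 1, by simp [crossing, crossEdge, dir]⟩
  · exact ⟨(x1, x2 - 1), 1, by simp [crossing, crossEdge, dir, sub_eq_add_neg]⟩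

lemma dualEdge_injective : Function.Injective (fun e : Edge => dualEdge e.1) := by
  intro e f hef
  obtain ⟨a, d, rfl⟩ := exists_crossing e
  obtain ⟨b, d', rfl⟩ := exists_crossing f
  simp only [crossing, dualEdge_crossEdge, Sym2.eq_iff] at hef
  have hcomm (x y : V) : crossEdge x y = crossEdge y x := by
    unfold crossEdge
    by_cases h : x.2 = y.2
    · simp [h, sup_comm]
    · simp [h, Ne.symm h, sup_comm]
  apply Subtype.ext
  simp only [crossing]
  rcases hef with ⟨h1, h2⟩ | ⟨h1, h2⟩
  · rw [h2, h1]
  · rw [h2, h1, hcomm]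

lemma contour_eq_of_dualEdge (σ : SpinConfig) {e : Edge} {a b : V}
    (h : dualEdge e.1 = s(a, b)) : contour σ e = (σ a != σ b) := by
  obtain ⟨e, he⟩ := e
  induction e using Sym2.ind with
  | _ x y =>
    simp only [dualEdge, Sym2.lift_mk, Sym2.eq_iff] at h
    simp only [contour, Sym2.lift_mk, contourPair]
    rcases h with ⟨h1, h2⟩ | ⟨h1, h2⟩
    · rw [h1, h2]
    · rw [h1, h2, bne_comm]

lemma contour_crossing (σ : SpinConfig) (a : V) (d : Fin 4) :
    contour σ (crossing a d) = (σ a != σ (a + dir d)) :=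
  contour_eq_of_dualEdge σ (dualEdge_crossEdge a d)

lemma image_dualEdge_EOf (Λ : Finset V) :
    (EOf Λ).image (fun e : Edge => dualEdge e.1) = dualEdges Λ := by
  rw [EOf, dualEdges, Finset.image_image]
  refine Finset.image_congr fun x _ => ?_
  exact dualEdge_crossEdge x.1 x.2

lemma crossing_mem_EOf {Λ : Finset V} {a : V} {d : Fin 4} :
    crossing a d ∈ EOf Λ ↔ a ∈ Λ ∨ a + dir d ∈ Λ := by
  rw [← dualEdge_injective.mem_finset_image, image_dualEdge_EOf]
  simp only [crossing, dualEdge_crossEdge, dualEdges, Finset.mem_image, Finset.mem_product,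
    Finset.mem_univ, and_true, Sym2.eq_iff]
  constructor
  · rintro ⟨⟨x, d'⟩, hx, ⟨rfl, -⟩ | ⟨rfl, -⟩⟩
    · exact Or.inl hx
    · exact Or.inr hx
  · rintro (h | h)
    · exact ⟨(a, d), h, Or.inl ⟨rfl, rfl⟩⟩
    · have hadj : latAdj (a + dir d) a := by
        have := latAdj_dir a d
        simpa only [latAdj, abs_sub_comm] using this
      obtain ⟨d', hd'⟩ := hadj.exists_dir
      exact ⟨(a + dir d, d'), h, Or.inr ⟨rfl, hd'.symm⟩⟩

lemma pairEnergy_dualEdge (σ : SpinConfig) (e : Edge) :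
    pairEnergy σ (dualEdge e.1) = 1 - 2 * (if contour σ e = true then 1 else 0) := by
  obtain ⟨a, d, rfl⟩ := exists_crossing e
  rw [contour_crossing]
  simp only [crossing, dualEdge_crossEdge, pairEnergy, Sym2.lift_mk, spinVal]
  cases σ a <;> cases σ (a + dir d) <;> norm_num

lemma hamiltonian_eq (Λ : Finset V) (σ : SpinConfig) :
    hamiltonian Λ σ =
      2 * (numOpen (fun e : ↥(EOf Λ) => contour σ e) : ℝ) - (EOf Λ).card := by
  rw [hamiltonian, ← image_dualEdge_EOf, Finset.sum_image dualEdge_injective.injOn]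
  simp only [pairEnergy_dualEdge, Finset.sum_sub_distrib, ← Finset.mul_sum, numOpen,
    Finset.card_filter, Nat.cast_sum]
  rw [← Finset.sum_coe_sort (EOf Λ) (fun e => if contour σ e = true then (1 : ℝ) else 0)]
  simp

lemma degEven_iff (ω : Config) (x : V) :
    degEven ω x ↔ ((ω (incEdge x 0) ^^ ω (incEdge x 1)) ^^
      (ω (incEdge x 2) ^^ ω (incEdge x 3))) = false := by
  simp only [degEven, Finset.card_filter, Fin.sum_univ_four]
  cases ω (incEdge x 0) <;> cases ω (incEdge x 1) <;> cases ω (incEdge x 2) <;>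
    cases ω (incEdge x 3) <;> decide

lemma incEdge_zero (a b : ℤ) : incEdge (a, b) 0 = crossing (a, b - 1) 2 := by
  simp [incEdge, crossing, crossEdge, dir]

lemma incEdge_one (a b : ℤ) : incEdge (a, b) 1 = crossing (a - 1, b - 1) 2 := by
  simp [incEdge, crossing, crossEdge, dir, sub_eq_add_neg]

lemma incEdge_two (a b : ℤ) : incEdge (a, b) 2 = crossing (a - 1, b) 0 := by
  simp [incEdge, crossing, crossEdge, dir]

lemma incEdge_three (a b : ℤ) : incEdge (a, b) 3 = crossing (a - 1, b - 1) 0 := by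
  simp [incEdge, crossing, crossEdge, dir, sub_eq_add_neg]

lemma contour_mem_ΩEP (σ : SpinConfig) : contour σ ∈ ΩEP := by
  rintro ⟨a, b⟩
  rw [degEven_iff, incEdge_zero, incEdge_one, incEdge_two, incEdge_three]
  simp only [contour_crossing]
  simp only [dir, Matrix.cons_val, Prod.mk_add_mk, sub_add_cancel, add_zero]
  cases σ (a, b) <;> cases σ (a - 1, b) <;> cases σ (a, b - 1) <;>
    cases σ (a - 1, b - 1) <;> rfl

lemma exists_xor_primitive (f : ℤ → Bool) :
    ∃ F : ℤ → Bool, F 0 = false ∧ ∀ n, F (n + 1) = (F n ^^ f n) := by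
  let P : ℕ → Bool := Nat.rec false (fun k b => b ^^ f k)
  let N : ℕ → Bool := Nat.rec false (fun k b => b ^^ f (-(k + 1)))
  refine ⟨fun n => if 0 ≤ n then P n.toNat else N (-n).toNat, by simp [P], fun n => ?_⟩
  rcases n with n | n
  · have h : (Int.ofNat n + 1).toNat = n + 1 := rfl
    have h0 : (0 : ℤ) ≤ Int.ofNat n + 1 := by simp; omega
    simp only [h, h0, if_true]
    simp [P]
  · have hN : N (n + 1) = (N n ^^ f (Int.negSucc n)) := by
      simp [N, Int.negSucc_eq]
    have h1 : ¬ (0 : ℤ) ≤ Int.negSucc n := by omega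
    have h2 : (-Int.negSucc n).toNat = n + 1 := by omega
    simp only [h1, h2, if_false, hN]
    rcases n with n | n
    · simp [N, P]
    · have h3 : ¬ (0 : ℤ) ≤ Int.negSucc (n + 1) + 1 := by omega
      have h4 : (-(Int.negSucc (n + 1) + 1)).toNat = n + 1 := by omega
      simp only [h3, h4, if_false]
      simp

lemma exists_contour_eq {ω : Config} (hω : ω ∈ ΩEP) : ∃ σ, contour σ = ω := by
  obtain ⟨A, -, hA⟩ := exists_xor_primitive fun a => ω (crossing (a, 0) 0)
  choose B hB0 hB using fun a => exists_xor_primitive fun b => ω (crossing (a, b) 2)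
  have hplaq (a b : ℤ) : ω (crossing (a, b + 1) 0) =
      (ω (crossing (a, b) 0) ^^ (ω (crossing (a, b) 2) ^^ ω (crossing (a + 1, b) 2))) := by
    have h := (degEven_iff ω (a + 1, b + 1)).1 (hω _)
    rw [incEdge_zero, incEdge_one, incEdge_two, incEdge_three] at h
    simp only [add_sub_cancel_right] at h
    revert h
    cases ω (crossing (a, b) 0) <;> cases ω (crossing (a, b) 2) <;>
      cases ω (crossing (a + 1, b) 2) <;> cases ω (crossing (a, b + 1) 0) <;> decide
  let σ : SpinConfig := fun u => A u.1 ^^ B u.1 u.2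
  have hv (a b : ℤ) : (σ (a, b) ^^ σ (a, b + 1)) = ω (crossing (a, b) 2) := by
    simp only [σ, hB]
    cases A a <;> cases B a b <;> simp
  have hh (a b : ℤ) : (σ (a, b) ^^ σ (a + 1, b)) = ω (crossing (a, b) 0) := by
    have step (b : ℤ) : ((σ (a, b) ^^ σ (a + 1, b)) = ω (crossing (a, b) 0)) ↔
        ((σ (a, b + 1) ^^ σ (a + 1, b + 1)) = ω (crossing (a, b + 1) 0)) := by
      rw [hplaq, ← hv a b, ← hv (a + 1) b]
      cases σ (a, b) <;> cases σ (a + 1, b) <;> cases σ (a, b + 1) <;>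
        cases σ (a + 1, b + 1) <;> simp
    induction b using Int.induction_on with
    | zero => simp only [σ, hB0, hA]; cases A a <;> simp
    | succ n ih => exact (step _).1 ih
    | pred n ih => exact (step _).2 (by simpa using ih)
  refine ⟨σ, funext fun e => ?_⟩
  obtain ⟨⟨a, b⟩, d, rfl⟩ := exists_crossing e
  have hrev1 : crossing (a, b) 1 = crossing (a - 1, b) 0 := by
    simp [crossing, crossEdge, dir]
  have hrev3 : crossing (a, b) 3 = crossing (a, b - 1) 2 := by
    simp [crossing, crossEdge, dir]
  have key (u v : ℤ) : contour σ (crossing (u, v) 0) = ω (crossing (u, v) 0) := by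
    rw [contour_crossing, ← hh]; simp [dir, Bool.xor]
  have key' (u v : ℤ) : contour σ (crossing (u, v) 2) = ω (crossing (u, v) 2) := by
    rw [contour_crossing, ← hv]; simp [dir, Bool.xor]
  fin_cases d
  · exact key a b
  · exact hrev1 ▸ key _ _
  · exact key' a b
  · exact hrev3 ▸ key' _ _

lemma contour_not (σ : SpinConfig) : contour (fun x => !σ x) = contour σ := by
  funext e
  obtain ⟨a, d, rfl⟩ := exists_crossing e
  simp only [contour_crossing]
  cases σ a <;> cases σ (a + dir d) <;> rfl

lemma agree_step {σ τ : SpinConfig} {a : V} {d : Fin 4}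
    (h : contour σ (crossing a d) = contour τ (crossing a d)) :
    σ a = τ a ↔ σ (a + dir d) = τ (a + dir d) := by
  simp only [contour_crossing] at h
  revert h
  cases σ a <;> cases σ (a + dir d) <;> cases τ a <;> cases τ (a + dir d) <;> decide

lemma agree_of_contour_eq {σ τ : SpinConfig} (h : contour σ = contour τ) {x : V}
    (hx : σ x = τ x) : σ = τ := by
  have hh (a b : ℤ) : σ (a, b) = τ (a, b) ↔ σ (a + 1, b) = τ (a + 1, b) := by
    simpa [dir] using agree_step (a := (a, b)) (d := 0) (congrFun h _)
  have hv (a b : ℤ) : σ (a, b) = τ (a, b) ↔ σ (a, b + 1) = τ (a, b + 1) := by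
    simpa [dir] using agree_step (a := (a, b)) (d := 2) (congrFun h _)
  have hh0 (a b : ℤ) : σ (a, b) = τ (a, b) ↔ σ (0, b) = τ (0, b) := by
    induction a using Int.induction_on with
    | zero => rfl
    | succ n ih => rw [← hh, ih]
    | pred n ih => rw [hh, sub_add_cancel, ih]
  have hv0 (b : ℤ) : σ (0, b) = τ (0, b) ↔ σ (0, 0) = τ (0, 0) := by
    induction b using Int.induction_on with
    | zero => rfl
    | succ n ih => rw [← hv, ih]
    | pred n ih => rw [hv, sub_add_cancel, ih]
  funext y
  exact (((hh0 y.1 y.2).trans (hv0 y.2)).trans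
    ((hh0 x.1 x.2).trans (hv0 x.2)).symm).2 hx

lemma agree_off {Λ : Finset V} (hΛ : ComplConnected Λ) {σ τ : SpinConfig}
    (h : ∀ e ∉ EOf Λ, contour σ e = contour τ e) {x y : V} (hx : x ∉ Λ) (hy : y ∉ Λ)
    (hxy : σ x = τ x) : σ y = τ y := by
  obtain ⟨n, γ, rfl, rfl, hadj, hγ⟩ := hΛ x y hx hy
  have (i : Fin (n + 1)) : σ (γ i) = τ (γ i) := by
    induction i using Fin.induction with
    | zero => exact hxy
    | succ i ih =>
      obtain ⟨d, hd⟩ := (hadj i).exists_dir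
      rw [hd]
      refine (agree_step (h _ fun hmem => ?_)).1 ih
      rcases crossing_mem_EOf.1 hmem with h' | h'
      · exact hγ _ h'
      · exact hγ _ (hd ▸ h')
  exact this _

lemma contour_eq_off {Λ : Finset V} {σ τ : SpinConfig} (h : ∀ x ∉ Λ, σ x = τ x)
    {e : Edge} (he : e ∉ EOf Λ) : contour σ e = contour τ e := by
  obtain ⟨a, d, rfl⟩ := exists_crossing e
  rw [crossing_mem_EOf, not_or] at he
  rw [contour_crossing, contour_crossing, h _ he.1, h _ he.2]

lemma spatch_of_notMem {Λ : Finset V} (η : ↥Λ → Bool) (c : SpinConfig) {x : V} (hx : x ∉ Λ) :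
    spatch Λ η c x = c x := by
  simp [spatch, hx]

/-- The restriction to `E(Λ)` of the contours of the spin configuration that equals `η` on `Λ`
and `c` off `Λ`. -/
def localContour (Λ : Finset V) (c : SpinConfig) (η : ↥Λ → Bool) : ↥(EOf Λ) → Bool :=
  fun e => contour (spatch Λ η c) e

lemma patch_localContour (Λ : Finset V) (c : SpinConfig) (η : ↥Λ → Bool) :
    patch (EOf Λ) (localContour Λ c η) (contour c) = contour (spatch Λ η c) := by
  funext e
  by_cases he : e ∈ EOf Λ
  · simp [patch, he, localContour]
  · simp only [patch, he, dif_neg, not_false_eq_true]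
    exact (contour_eq_off (fun x hx => spatch_of_notMem η c hx) he).symm

lemma localContour_injective (Λ : Finset V) (c : SpinConfig) :
    Function.Injective (localContour Λ c) := by
  intro η η' h
  obtain ⟨x, hx⟩ := Infinite.exists_notMem_finset Λ
  have hσ : spatch Λ η c = spatch Λ η' c := by
    refine agree_of_contour_eq ?_ (x := x)
      ((spatch_of_notMem η c hx).trans (spatch_of_notMem η' c hx).symm)
    rw [← patch_localContour, ← patch_localContour, h]
  funext y
  simpa [spatch] using congrFun hσ y

lemma exists_localContour_eq {Λ : Finset V} (hΛ : ComplConnected Λ) (c : SpinConfig)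
    (ξ : ↥(EOf Λ) → Bool) (hξ : patch (EOf Λ) ξ (contour c) ∈ ΩEP) :
    ∃ η, localContour Λ c η = ξ := by
  obtain ⟨x, hx⟩ := Infinite.exists_notMem_finset Λ
  obtain ⟨σ, hσ, hσx⟩ : ∃ σ, contour σ = patch (EOf Λ) ξ (contour c) ∧ σ x = c x := by
    obtain ⟨σ, hσ⟩ := exists_contour_eq hξ
    by_cases h : σ x = c x
    · exact ⟨σ, hσ, h⟩
    · exact ⟨_, (contour_not σ).trans hσ, (Bool.eq_not.2 h) ▸ Bool.not_not _⟩
  have hoff : ∀ y ∉ Λ, σ y = c y := fun y hy =>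
    agree_off hΛ (fun e he => by simp [hσ, patch, he]) hx hy hσx
  refine ⟨fun y => σ y, funext fun e => ?_⟩
  have hsp : spatch Λ (fun y => σ y) c = σ := by
    funext y
    by_cases hy : y ∈ Λ
    · simp [spatch, hy]
    · simp [spatch, hy, hoff y hy]
  simp [localContour, hsp, hσ, patch]

lemma exp_hamiltonian_eq {p β : ℝ} (hp0 : 0 < p) (hp1 : p < 1)
    (hβ : β = (1 / 2) * Real.log ((1 - p) / p)) (Λ : Finset V) (c : SpinConfig)
    (η : ↥Λ → Bool) :
    Real.exp (-β * hamiltonian Λ (spatch Λ η c)) =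
      Real.exp (β * (EOf Λ).card) * epWeight p (EOf Λ) (contour c) (localContour Λ c η) := by
  have hq : qratio p = Real.exp (-(2 * β)) := by
    have h1 : 0 < 1 - p := sub_pos.2 hp1
    have h2 : -(2 * β) = Real.log (p / (1 - p)) := by
      rw [hβ, ← inv_div p (1 - p), Real.log_inv]; ring
    rw [h2, Real.exp_log (div_pos hp0 h1), qratio]
  rw [epWeight, if_pos (by rw [patch_localContour]; exact contour_mem_ΩEP _), hq,
    ← Real.exp_nat_mul, ← Real.exp_add, hamiltonian_eq]
  congr 1
  change _ = _ + (numOpen (fun e : ↥(EOf Λ) => contour (spatch Λ η c) e) : ℝ) * _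
  ring

lemma measurable_contour : Measurable contour := by
  refine measurable_pi_lambda _ fun e => ?_
  obtain ⟨a, d, rfl⟩ := exists_crossing e
  simp only [contour_crossing]
  have h : Measurable fun σ : SpinConfig => (σ a, σ (a + dir d)) :=
    (measurable_pi_apply a).prodMk (measurable_pi_apply (a + dir d))
  exact (measurable_of_countable fun q : Bool × Bool => q.1 != q.2).comp h

/-- Let `p ∈ (0,1)`, `β = (1/2) log((1-p)/p)`, `c` a spin configuration and
`η = Γ(c)`. If `Λ_*` is a finite set of dual sites with connected complement, then the
finite-volume even percolation measure `μ^p_{E(Λ_*),η}` is the image of the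
finite-volume Ising measure `Π^β_{Λ_*,c}` under the contour map. -/
theorem finite_volume_even_is_contour_of_ising (p : ℝ) (hp0 : 0 < p) (hp1 : p < 1)
    (β : ℝ) (hβ : β = (1 / 2) * Real.log ((1 - p) / p))
    (c : SpinConfig) (Λ : Finset V) (hΛ : ComplConnected Λ) :
    epFinVol p (EOf Λ) (contour c) = (isingFinVol β Λ c).map contour := by
  set K := ENNReal.ofReal (Real.exp (β * (EOf Λ).card))
  have hK0 : K ≠ 0 := by simpa [K] using Real.exp_pos _
  have hKtop : K ≠ ⊤ := ENNReal.ofReal_ne_top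
  have hw (η : ↥Λ → Bool) : ENNReal.ofReal (Real.exp (-β * hamiltonian Λ (spatch Λ η c))) =
      K * ENNReal.ofReal (epWeight p (EOf Λ) (contour c) (localContour Λ c η)) := by
    rw [exp_hamiltonian_eq hp0 hp1 hβ, ENNReal.ofReal_mul (Real.exp_pos _).le]
  have hzero (ξ : ↥(EOf Λ) → Bool) (hξ : ξ ∉ Set.range (localContour Λ c)) :
      ENNReal.ofReal (epWeight p (EOf Λ) (contour c) ξ) = 0 := by
    rw [epWeight, if_neg fun h => hξ (exists_localContour_eq hΛ c ξ h), ENNReal.ofReal_zero]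
  have hZ : ENNReal.ofReal (Zpart β Λ c) =
      K * ∑ ξ, ENNReal.ofReal (epWeight p (EOf Λ) (contour c) ξ) := by
    rw [Zpart, ENNReal.ofReal_sum_of_nonneg fun _ _ => (Real.exp_pos _).le, Finset.mul_sum]
    exact Fintype.sum_of_injective _ (localContour_injective Λ c) _ _
      (fun ξ hξ => by rw [hzero ξ hξ, mul_zero]) hw
  have hmap : (∑ η : ↥Λ → Bool,
      ENNReal.ofReal (Real.exp (-β * hamiltonian Λ (spatch Λ η c))) •
        Measure.dirac (spatch Λ η c)).map contour =
      K • ∑ ξ, ENNReal.ofReal (epWeight p (EOf Λ) (contour c) ξ) •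
        Measure.dirac (patch (EOf Λ) ξ (contour c)) := by
    rw [← Measure.mapₗ_apply_of_measurable measurable_contour, map_sum, Finset.smul_sum]
    refine Fintype.sum_of_injective _ (localContour_injective Λ c) _ _
      (fun ξ hξ => by rw [hzero ξ hξ, zero_smul, smul_zero]) fun η => ?_
    rw [Measure.mapₗ_apply_of_measurable measurable_contour, Measure.map_smul,
      Measure.map_dirac' measurable_contour, hw, patch_localContour, mul_smul]
  rw [epFinVol, isingFinVol, Measure.map_smul, hmap, hZ, smul_smul,
    ENNReal.mul_inv (Or.inl hK0) (Or.inl hKtop), mul_right_comm,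
    ENNReal.inv_mul_cancel hK0 hKtop, one_mul]

end
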